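/- arXiv:2507.05988 — 4 statements merged into one kernel-verified Lean document; each statement's English description precedes it below -/
import Mathlib

section
/- Let H and X be complex Hilbert spaces, D ⊆ H a linear subspace, and T : D → X a linear map that preserves orthogonality, i.e., for all v₁, v₂ ∈ D, ⟨v₁, v₂⟩ = 0 implies ⟨Tv₁, Tv₂⟩ = 0. Then for all v, w ∈ D with ‖v‖ = ‖w‖ = 1 one has ⟨Tv, Tw⟩ = ⟨v, w⟩ · ‖Tv‖². -/
local notation "⟪" x ", " y "⟫_ℂ" => @inner ℂ _ _ x y

/-- Let `H` and `X` be complex Hilbert spaces, `D ⊆ H` a linear subspace, and `T : D → X` a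
linear map preserving orthogonality (`⟪v₁, v₂⟫ = 0 → ⟪T v₁, T v₂⟫ = 0`).  Then for all
`v, w ∈ D` with `‖v‖ = ‖w‖ = 1` one has `⟪T v, T w⟫ = ⟪v, w⟫ * ‖T v‖²`. -/
theorem stmt2 {H X : Type*}
    [NormedAddCommGroup H] [InnerProductSpace ℂ H] [CompleteSpace H]
    [NormedAddCommGroup X] [InnerProductSpace ℂ X] [CompleteSpace X]
    (D : Submodule ℂ H) (T : D →ₗ[ℂ] X)
    (hT : ∀ v₁ v₂ : D, ⟪(v₁ : H), (v₂ : H)⟫_ℂ = 0 → ⟪T v₁, T v₂⟫_ℂ = 0)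
    (v w : D) (hv : ‖(v : H)‖ = 1) (hw : ‖(w : H)‖ = 1) :
    ⟪T v, T w⟫_ℂ = ⟪(v : H), (w : H)⟫_ℂ * (‖T v‖ : ℂ) ^ 2 := by
  have h := hT v (w - (inner ℂ (v : H) (w : H)) • v) (by
    rw [Submodule.coe_sub, Submodule.coe_smul, inner_sub_right, inner_smul_right,
      inner_self_eq_norm_sq_to_K, hv]
    simp)
  rw [map_sub, map_smul, inner_sub_right, inner_smul_right,
    inner_self_eq_norm_sq_to_K, sub_eq_zero] at h
  exact h
end

section
/- Let H and X be complex Hilbert spaces, D ⊆ H a linear subspace, and T : D → X a linear map that preserves orthogonality, i.e., for all v₁, v₂ ∈ D, ⟨v₁, v₂⟩ = 0 implies ⟨Tv₁, Tv₂⟩ = 0. Then ‖Tv‖ = ‖Tw‖ for all v, w ∈ D with ‖v‖ = ‖w‖ = 1; that is, T has constant norm on the unit sphere of D. -/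
local notation "⟪" x ", " y "⟫_ℂ" => @inner ℂ _ _ x y

/-- Let `H` and `X` be complex Hilbert spaces, `D ⊆ H` a linear subspace, and `T : D → X` a
linear map preserving orthogonality (`⟪v₁, v₂⟫ = 0 → ⟪T v₁, T v₂⟫ = 0`).  Then
`‖T v‖ = ‖T w‖` for all `v, w ∈ D` with `‖v‖ = ‖w‖ = 1`; that is, `T` has constant norm on
the unit sphere of `D`. -/
theorem stmt3 {H X : Type*}
    [NormedAddCommGroup H] [InnerProductSpace ℂ H] [CompleteSpace H]
    [NormedAddCommGroup X] [InnerProductSpace ℂ X] [CompleteSpace X]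
    (D : Submodule ℂ H) (T : D →ₗ[ℂ] X)
    (hT : ∀ v₁ v₂ : D, ⟪(v₁ : H), (v₂ : H)⟫_ℂ = 0 → ⟪T v₁, T v₂⟫_ℂ = 0)
    (v w : D) (hv : ‖(v : H)‖ = 1) (hw : ‖(w : H)‖ = 1) :
    ‖T v‖ = ‖T w‖ := by
  have hvv : ⟪(v : H), (v : H)⟫_ℂ = 1 := by
    rw [inner_self_eq_norm_sq_to_K, hv]; simp
  have hww : ⟪(w : H), (w : H)⟫_ℂ = 1 := by
    rw [inner_self_eq_norm_sq_to_K, hw]; simp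
  suffices h : ⟪T v, T v⟫_ℂ = ⟪T w, T w⟫_ℂ by
    rw [inner_self_eq_norm_sq_to_K, inner_self_eq_norm_sq_to_K] at h
    have h2 : ‖T v‖ ^ 2 = ‖T w‖ ^ 2 := by exact_mod_cast h
    exact (sq_eq_sq₀ (norm_nonneg _) (norm_nonneg _)).1 h2
  by_cases hc : ⟪(v : H), (w : H)⟫_ℂ = 0
  · have hc' : ⟪(w : H), (v : H)⟫_ℂ = 0 := inner_eq_zero_symm.1 hc
    have h := hT (v + w) (v - w) (by
      simp only [Submodule.coe_add, Submodule.coe_sub, inner_add_left, inner_sub_right,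
        hvv, hww, hc, hc']
      ring)
    simp only [map_add, map_sub, inner_add_left, inner_sub_right, hT v w hc, hT w v hc'] at h
    linear_combination h
  · have h1 := hT v (w - ⟪(v : H), (w : H)⟫_ℂ • v) (by
      simp only [Submodule.coe_sub, Submodule.coe_smul, inner_sub_right, inner_smul_right, hvv]
      ring)
    have h2 := hT (v - ⟪(w : H), (v : H)⟫_ℂ • w) w (by
      simp only [Submodule.coe_sub, Submodule.coe_smul, inner_sub_left, inner_smul_left, hww,
        inner_conj_symm]
      ring)
    simp only [map_sub, map_smul, inner_sub_right, inner_smul_right] at h1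
    simp only [map_sub, map_smul, inner_sub_left, inner_smul_left, inner_conj_symm] at h2
    apply mul_left_cancel₀ hc
    linear_combination h2 - h1
end

section
/- Let H and X be complex Hilbert spaces, D ⊆ H a dense linear subspace, and T : D → X a linear map that preserves orthogonality, i.e., for all v₁, v₂ ∈ D, ⟨v₁, v₂⟩ = 0 implies ⟨Tv₁, Tv₂⟩ = 0. Then there exists λ₀ ≥ 0 such that ⟨Tv, Tw⟩ = λ₀² ⟨v, w⟩ for all v, w ∈ D; consequently T extends uniquely to a bounded linear operator T̄ : H → X satisfying ⟨T̄v, T̄w⟩ = λ₀² ⟨v, w⟩ for all v, w ∈ H, i.e., T̄ is a scalar multiple of a linear isometry. -/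
local notation "⟪" x ", " y "⟫_ℂ" => @inner ℂ _ _ x y

/-- Let `H` and `X` be complex Hilbert spaces, `D ⊆ H` a dense linear subspace, and `T : D → X`
a linear map preserving orthogonality. Then there exists `λ₀ ≥ 0` such that
`⟪T v, T w⟫ = λ₀² ⟪v, w⟫` for all `v, w ∈ D`; consequently `T` extends uniquely to a
bounded linear operator `T̄ : H → X` satisfying `⟪T̄ v, T̄ w⟫ = λ₀² ⟪v, w⟫` for all
`v, w ∈ H`, i.e. `T̄` is a scalar multiple of a linear isometry. -/
theorem stmt4 {H X : Type*}
    [NormedAddCommGroup H] [InnerProductSpace ℂ H] [CompleteSpace H]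
    [NormedAddCommGroup X] [InnerProductSpace ℂ X] [CompleteSpace X]
    (D : Submodule ℂ H) (hD : Dense (D : Set H)) (T : D →ₗ[ℂ] X)
    (hT : ∀ v₁ v₂ : D, ⟪(v₁ : H), (v₂ : H)⟫_ℂ = 0 → ⟪T v₁, T v₂⟫_ℂ = 0) :
    ∃ l₀ : ℝ, 0 ≤ l₀ ∧
      (∀ v w : D, ⟪T v, T w⟫_ℂ = (l₀ : ℂ) ^ 2 * ⟪(v : H), (w : H)⟫_ℂ) ∧
      ∃! Tbar : H →L[ℂ] X,
        (∀ v : D, Tbar (v : H) = T v) ∧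
        (∀ v w : H, ⟪Tbar v, Tbar w⟫_ℂ = (l₀ : ℂ) ^ 2 * ⟪v, w⟫_ℂ) := by
  have hA : ∀ v w : D, ⟪(v : H), (v : H)⟫_ℂ * ⟪T v, T w⟫_ℂ
      = ⟪(v : H), (w : H)⟫_ℂ * ⟪T v, T v⟫_ℂ := by
    intro v w
    have h := hT v (⟪(v : H), (v : H)⟫_ℂ • w - ⟪(v : H), (w : H)⟫_ℂ • v) (by
      simp only [Submodule.coe_sub, Submodule.coe_smul, inner_sub_right, inner_smul_right]
      ring)
    simp only [map_sub, map_smul, inner_sub_right, inner_smul_right] at h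
    exact sub_eq_zero.mp h
  have hA' : ∀ v w : D, ⟪(w : H), (w : H)⟫_ℂ * ⟪T v, T w⟫_ℂ
      = ⟪(v : H), (w : H)⟫_ℂ * ⟪T w, T w⟫_ℂ := by
    intro v w
    have h := congrArg (starRingEnd ℂ) (hA w v)
    simpa only [map_mul, inner_conj_symm] using h
  have hC : ∀ v w : D, ⟪(v : H), (w : H)⟫_ℂ ≠ 0 →
      ⟪(v : H), (v : H)⟫_ℂ * ⟪T w, T w⟫_ℂ = ⟪(w : H), (w : H)⟫_ℂ * ⟪T v, T v⟫_ℂ := by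
    intro v w h
    apply mul_left_cancel₀ h
    linear_combination ⟪(w : H), (w : H)⟫_ℂ * hA v w - ⟪(v : H), (v : H)⟫_ℂ * hA' v w
  have key : ∃ l₀ : ℝ, 0 ≤ l₀ ∧
      ∀ v w : D, ⟪T v, T w⟫_ℂ = (l₀ : ℂ) ^ 2 * ⟪(v : H), (w : H)⟫_ℂ := by
    by_cases hu : ∃ u : D, u ≠ 0
    · obtain ⟨u, hu⟩ := hu
      have nz : ∀ v : D, v ≠ 0 → ⟪(v : H), (v : H)⟫_ℂ ≠ 0 := by
        intro v hv h
        exact hv (Subtype.ext (inner_self_eq_zero.mp h))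
      have hE : ∀ w : D, w ≠ 0 →
          ⟪(u : H), (u : H)⟫_ℂ * ⟪T w, T w⟫_ℂ = ⟪(w : H), (w : H)⟫_ℂ * ⟪T u, T u⟫_ℂ := by
        intro w hw
        by_cases h : ⟪(u : H), (w : H)⟫_ℂ = 0
        · have h' : ⟪(w : H), (u : H)⟫_ℂ = 0 := inner_eq_zero_symm.mp h
          have e1 : ⟪(u : H), ((u + w : D) : H)⟫_ℂ = ⟪(u : H), (u : H)⟫_ℂ := by
            rw [Submodule.coe_add, inner_add_right, h, add_zero]
          have e2 : ⟪(w : H), ((u + w : D) : H)⟫_ℂ = ⟪(w : H), (w : H)⟫_ℂ := by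
            rw [Submodule.coe_add, inner_add_right, h', zero_add]
          have hz : u + w ≠ 0 := by
            intro hz
            rw [hz] at e1
            exact nz u hu (by simpa using e1.symm)
          have c1 := hC u (u + w) (by rw [e1]; exact nz u hu)
          have c2 := hC w (u + w) (by rw [e2]; exact nz w hw)
          apply mul_left_cancel₀ (nz _ hz)
          linear_combination ⟪(w : H), (w : H)⟫_ℂ * c1 - ⟪(u : H), (u : H)⟫_ℂ * c2
        · exact hC u w h
      refine ⟨‖T u‖ / ‖u‖, by positivity, fun v w => ?_⟩
      have hl : ((‖T u‖ / ‖u‖ : ℝ) : ℂ) ^ 2 = ⟪T u, T u⟫_ℂ / ⟪(u : H), (u : H)⟫_ℂ := by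
        rw [inner_self_eq_norm_sq_to_K, inner_self_eq_norm_sq_to_K]
        push_cast
        rw [div_pow]
        rfl
      rw [hl]
      by_cases hv : v = 0
      · simp [hv]
      · have h1 := nz u hu
        have h2 := nz v hv
        rw [div_mul_eq_mul_div, eq_div_iff h1]
        apply mul_left_cancel₀ h2
        linear_combination ⟪(u : H), (u : H)⟫_ℂ * hA v w + ⟪(v : H), (w : H)⟫_ℂ * hE v hv
    · push Not at hu
      refine ⟨0, le_rfl, fun v w => ?_⟩
      simp [hu v]
  obtain ⟨l₀, hl, h⟩ := key
  refine ⟨l₀, hl, h, ?_⟩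
  have hd : DenseRange D.subtype := by
    simpa [DenseRange] using hD
  have hn : ∃ C, ∀ x, ‖T x‖ ≤ C * ‖D.subtype x‖ := by
    refine ⟨l₀, fun x => ?_⟩
    have hx := h x x
    rw [inner_self_eq_norm_sq_to_K, inner_self_eq_norm_sq_to_K] at hx
    have hx' : ‖T x‖ ^ 2 = l₀ ^ 2 * ‖(x : H)‖ ^ 2 := by
      have hx2 : ((‖T x‖ : ℂ)) ^ 2 = (l₀ : ℂ) ^ 2 * (‖(x : H)‖ : ℂ) ^ 2 := hx
      exact_mod_cast hx2
    refine (sq_le_sq₀ (norm_nonneg _) (by positivity)).mp ?_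
    rw [mul_pow]
    exact hx'.le
  have hext : ∀ v : D, T.extendOfNorm D.subtype (v : H) = T v := fun v =>
    LinearMap.extendOfNorm_eq hd hn v
  refine ⟨T.extendOfNorm D.subtype, ⟨hext, ?_⟩, ?_⟩
  · refine hd.induction_on₂ (isClosed_eq (by fun_prop) (by fun_prop)) ?_
    intro v w
    simp only [Submodule.subtype_apply, hext]
    exact h v w
  · rintro S ⟨hS, -⟩
    apply ContinuousLinearMap.coeFn_injective
    refine hd.equalizer S.continuous (ContinuousLinearMap.continuous _) ?_
    funext v
    simp only [Function.comp, Submodule.subtype_apply, hext, hS]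
end

section
/- Let X be a nonzero complex Hilbert space together with an injective continuous linear map ι : X → 𝓢'(ℝ^d) into the space of tempered distributions (the continuous dual of the Schwartz space 𝓢(ℝ^d), with its weak-* topology). For x, ξ ∈ ℝ^d let T_{x,ξ} denote the time–frequency shift on tempered distributions, i.e., the continuous extension to 𝓢'(ℝ^d) of the operator f ↦ f(· − x) e^{i⟨·,ξ⟩} on functions, defined by duality as the transpose of the corresponding continuous linear operator on 𝓢(ℝ^d). Assume there is a constant C₀ > 0 such that for every f ∈ X and all x, ξ ∈ ℝ^d the distribution T_{x,ξ}(ι f) lies in ι(X) and ‖ι^{-1}(T_{x,ξ}(ι f))‖_X ≤ C₀ ‖f‖_X. Then ι(X) coincides with the image of L²(ℝ^d; ℂ) under its canonical embedding into 𝓢'(ℝ^d), and there exist constants c, C > 0 such that c ‖g‖_{L²} ≤ ‖ι^{-1}(g)‖_X ≤ C ‖g‖_{L²} for every g ∈ L²(ℝ^d; ℂ); i.e., X = L²(ℝ^d) with equivalent norms. -/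
open MeasureTheory
local notation "⟪" x ", " y "⟫_ℝ" => @inner ℝ _ _ x y

namespace TFInv
open scoped SchwartzMap ContDiff BoundedContinuousFunction

section Interchange
variable {E : Type} [NormedAddCommGroup E] [NormedSpace ℝ E]

theorem iter_slice {V : Type*} [NormedAddCommGroup V] [NormedSpace ℝ V]
    (F : 𝓢(E × E, V)) (l : ℕ) (z y : E) :
    iteratedFDeriv ℝ l (fun y => F (z, y)) y =
      (iteratedFDeriv ℝ l F (z, y)).compContinuousLinearMap
        (fun _ => ContinuousLinearMap.inr ℝ E E) := by
  have h1 : (fun y => F (z, y)) =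
      (fun p : E × E => F (p + (z, 0))) ∘ (ContinuousLinearMap.inr ℝ E E) := by
    ext y; simp
  have hs : ContDiff ℝ ∞ (fun p : E × E => F (p + (z, 0))) :=
    (F.smooth ⊤).comp (contDiff_id.add contDiff_const)
  rw [h1, ContinuousLinearMap.iteratedFDeriv_comp_right _ hs _ (i := l) (by exact_mod_cast le_top)]
  rw [iteratedFDeriv_comp_add_right]
  simp

theorem norm_comp_inr_le {V : Type*} [NormedAddCommGroup V] [NormedSpace ℝ V] {l : ℕ}
    (T : (E × E) [×l]→L[ℝ] V) :
    ‖T.compContinuousLinearMap (fun _ => ContinuousLinearMap.inr ℝ E E)‖ ≤ ‖T‖ := by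
  refine (T.norm_compContinuousLinearMap_le _).trans ?_
  have : ∏ _i : Fin l, ‖ContinuousLinearMap.inr ℝ E E‖ ≤ 1 :=
    Finset.prod_le_one (fun _ _ => norm_nonneg _)
      (fun _ _ => ContinuousLinearMap.norm_inr_le_one ℝ E E)
  nlinarith [norm_nonneg T]

theorem slice_bound {V : Type*} [NormedAddCommGroup V] [NormedSpace ℝ V]
    (F : 𝓢(E × E, V)) (n k l : ℕ) (z y : E) :
    ‖z‖ ^ n * (‖y‖ ^ k * ‖iteratedFDeriv ℝ l (fun y => F (z, y)) y‖) ≤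
      SchwartzMap.seminorm ℝ (n + k) l F := by
  rw [iter_slice]
  refine le_trans ?_ (SchwartzMap.le_seminorm ℝ (n + k) l F (z, y))
  rw [pow_add, mul_assoc]
  gcongr
  · exact norm_fst_le (z, y)
  · exact norm_snd_le (z, y)
  · exact norm_comp_inr_le _

theorem slice_lip {V : Type*} [NormedAddCommGroup V] [NormedSpace ℝ V]
    (F : 𝓢(E × E, V)) (k l : ℕ) (z z' y : E) :
    ‖y‖ ^ k * ‖iteratedFDeriv ℝ l (fun y => F (z, y)) y -
        iteratedFDeriv ℝ l (fun y => F (z', y)) y‖ ≤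
      SchwartzMap.seminorm ℝ k (l + 1) F * ‖z - z'‖ := by
  rw [iter_slice, iter_slice]
  have e1 : (iteratedFDeriv ℝ l F (z, y)).compContinuousLinearMap
        (fun _ => ContinuousLinearMap.inr ℝ E E) - (iteratedFDeriv ℝ l F (z', y)).compContinuousLinearMap
        (fun _ => ContinuousLinearMap.inr ℝ E E) = (iteratedFDeriv ℝ l F (z, y) - iteratedFDeriv ℝ l F (z', y)).compContinuousLinearMap
        (fun _ => ContinuousLinearMap.inr ℝ E E) := by
    ext; simp
  rw [e1]
  refine le_trans (mul_le_mul_of_nonneg_left (norm_comp_inr_le _) (by positivity)) ?_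
  have hd : Differentiable ℝ (iteratedFDeriv ℝ l F) :=
    (F.smooth ⊤).differentiable_iteratedFDeriv (by exact_mod_cast WithTop.coe_lt_top _)
  have hder : ∀ w : E, HasFDerivAt (fun w : E => (‖y‖ ^ k) • iteratedFDeriv ℝ l F (w, y))
      ((‖y‖ ^ k) • (fderiv ℝ (iteratedFDeriv ℝ l F) (w, y)).comp (ContinuousLinearMap.inl ℝ E E)) w := by
    intro w
    have h1 := (hd (w, y)).hasFDerivAt
    exact (HasFDerivAt.comp (f := fun w : E => (w, y)) w h1
      (hasFDerivAt_prodMk_left (𝕜 := ℝ) w y)).const_smul (‖y‖ ^ k)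
  have := Convex.norm_image_sub_le_of_norm_hasFDerivWithin_le (C := SchwartzMap.seminorm ℝ k (l + 1) F) (s := Set.univ)
    (f := fun w : E => (‖y‖ ^ k) • iteratedFDeriv ℝ l F (w, y)) (x := z') (y := z)
    (fun w _ => (hder w).hasFDerivWithinAt) (fun w _ => ?_) convex_univ trivial trivial
  · rw [← smul_sub, norm_smul, norm_pow, norm_norm] at this
    exact this
  · rw [norm_smul, norm_pow, norm_norm]
    have h2 := SchwartzMap.le_seminorm ℝ k (l + 1) F (w, y)
    rw [← norm_fderiv_iteratedFDeriv] at h2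
    refine le_trans ?_ h2
    have h3 : ‖(fderiv ℝ (iteratedFDeriv ℝ l F) (w, y)).comp (ContinuousLinearMap.inl ℝ E E)‖ ≤
        ‖fderiv ℝ (iteratedFDeriv ℝ l F) (w, y)‖ := by
      refine (ContinuousLinearMap.opNorm_comp_le _ _).trans ?_
      exact mul_le_of_le_one_right (norm_nonneg _) (ContinuousLinearMap.norm_inl_le_one ℝ E E)
    gcongr
    exact norm_snd_le (w, y)

variable [MeasurableSpace E] [BorelSpace E] [FiniteDimensional ℝ E]
  (μ : Measure E) [μ.HasTemperateGrowth]

theorem slice_iter_integrable {V : Type*} [NormedAddCommGroup V] [NormedSpace ℝ V]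
    (F : 𝓢(E × E, V)) (l : ℕ) (y : E) :
    Integrable (fun z => iteratedFDeriv ℝ l (fun y => F (z, y)) y) μ := by
  have hc : Continuous (fun z => iteratedFDeriv ℝ l (fun y => F (z, y)) y) := by
    refine (LipschitzWith.of_dist_le_mul (K := Real.toNNReal (SchwartzMap.seminorm ℝ 0 (l + 1) F)) ?_).continuous
    intro z z'
    have := slice_lip F 0 l z z' y
    rw [dist_eq_norm, dist_eq_norm, Real.coe_toNNReal _ (apply_nonneg _ _)]
    simpa using this
  have h := integrable_of_le_of_pow_mul_le (μ := μ) (k := 0) (f := fun z => iteratedFDeriv ℝ l (fun y => F (z, y)) y)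
    (C₁ := SchwartzMap.seminorm ℝ 0 l F) (C₂ := SchwartzMap.seminorm ℝ (0 + μ.integrablePower) l F)
    (fun z => by simpa using slice_bound F 0 0 l z y)
    (fun z => by simpa using slice_bound F (0 + μ.integrablePower) 0 l z y)
    hc.aestronglyMeasurable
  simp only [pow_zero, one_mul] at h
  exact (integrable_norm_iff hc.aestronglyMeasurable).1 h

theorem iter_integral (l : ℕ) : ∀ {V : Type} [NormedAddCommGroup V] [NormedSpace ℝ V]
    [CompleteSpace V] (F : 𝓢(E × E, V)) (y : E),
    iteratedFDeriv ℝ l (fun y => ∫ z, F (z, y) ∂μ) y =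
      ∫ z, iteratedFDeriv ℝ l (fun y => F (z, y)) y ∂μ := by
  induction l with
  | zero =>
    intro V _ _ _ F y
    simp only [iteratedFDeriv_zero_eq_comp]
    exact ((continuousMultilinearCurryFin0 ℝ E V).symm.toLinearIsometry.toContinuousLinearMap.integral_comp_comm
      (by simpa [iteratedFDeriv_zero_eq_comp] using
        ((continuousMultilinearCurryFin0 ℝ E V).toLinearIsometry.toContinuousLinearMap.integrable_comp
          (slice_iter_integrable μ F 0 y)))).symm
  | succ l ih =>
    intro V _ _ _ F y
    let F1 : 𝓢(E × E, E →L[ℝ] V) := SchwartzMap.postcompCLM (𝕜 := ℝ)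
      ((ContinuousLinearMap.compL ℝ E (E × E) V).flip (ContinuousLinearMap.inr ℝ E E))
      (SchwartzMap.fderivCLM ℝ (E × E) V F)
    have hF1 : ∀ z y, HasFDerivAt (fun y => F (z, y)) (F1 (z, y)) y := by
      intro z y
      have h1 := (F.differentiableAt (x := (z, y))).hasFDerivAt
      exact (HasFDerivAt.comp (f := fun w : E => (z, w)) y h1
        (hasFDerivAt_prodMk_right (𝕜 := ℝ) z y))
    have hF1' : ∀ z, fderiv ℝ (fun y => F (z, y)) = fun y => F1 (z, y) := fun z =>
      funext fun y => (hF1 z y).fderiv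
    have hi : ∀ y, Integrable (fun z => F1 (z, y)) μ := fun y => by
      simpa [iteratedFDeriv_zero_eq_comp] using
        ((continuousMultilinearCurryFin0 ℝ E (E →L[ℝ] V)).toLinearIsometry.toContinuousLinearMap.integrable_comp
          (slice_iter_integrable μ F1 0 y))
    have hi0 : ∀ y, Integrable (fun z => F (z, y)) μ := fun y => by
      simpa [iteratedFDeriv_zero_eq_comp] using
        ((continuousMultilinearCurryFin0 ℝ E V).toLinearIsometry.toContinuousLinearMap.integrable_comp
          (slice_iter_integrable μ F 0 y))
    have hfd : fderiv ℝ (fun y => ∫ z, F (z, y) ∂μ) = fun y => ∫ z, F1 (z, y) ∂μ := by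
      funext y
      refine HasFDerivAt.fderiv ?_
      let N := μ.integrablePower
      refine hasFDerivAt_integral_of_dominated_of_fderiv_le (F := fun y z => F (z, y)) (F' := fun y z => F1 (z, y))
        (bound := fun z => (2 ^ N * (SchwartzMap.seminorm ℝ (0 + 0) 0 F1 + SchwartzMap.seminorm ℝ (N + 0) 0 F1)) * (1 + ‖z‖) ^ (-(N : ℝ)))
        (s := Set.univ) Filter.univ_mem (Filter.Eventually.of_forall fun y => (hi0 y).aestronglyMeasurable)
        (hi0 y) (hi y).aestronglyMeasurable ?_ ?_ ?_
      · refine Filter.Eventually.of_forall fun z y _ => ?_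
        have a := pow_mul_le_of_le_of_pow_mul_le (k := 0) (l := N) (C₁ := SchwartzMap.seminorm ℝ (0 + 0) 0 F1)
          (C₂ := SchwartzMap.seminorm ℝ (N + 0) 0 F1) (norm_nonneg z) (norm_nonneg (F1 (z, y)))
          (by simpa using slice_bound F1 0 0 0 z y) (by simpa using slice_bound F1 N 0 0 z y)
        simpa using a
      · exact (MeasureTheory.Measure.integrable_pow_neg_integrablePower μ).const_mul _
      · exact Filter.Eventually.of_forall fun z y _ => hF1 z y
    rw [iteratedFDeriv_succ_eq_comp_right]
    simp only [iteratedFDeriv_succ_eq_comp_right, Function.comp_apply, hfd, hF1']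
    rw [ih F1 y]
    exact ((continuousMultilinearCurryRightEquiv' ℝ l E V).symm.toLinearIsometry.toContinuousLinearMap.integral_comp_comm
      (slice_iter_integrable μ F1 l y)).symm
end Interchange
end TFInv


namespace TFInv
open scoped SchwartzMap ContDiff BoundedContinuousFunction
section Interchange2

theorem aux_smul_sub {V : Type*} [NormedAddCommGroup V] [NormedSpace ℝ V] (a : ℝ) (ha : 0 ≤ a)
    (x y : V) : ‖a • x - a • y‖ = a * ‖x - y‖ := by
  rw [← smul_sub, norm_smul, Real.norm_of_nonneg ha]

theorem exists_factor {V B : Type*} [AddCommGroup V] [Module ℂ V] [NormedAddCommGroup B]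
    [NormedSpace ℂ B] (J : V →ₗ[ℂ] B) (u : V →ₗ[ℂ] ℂ) (C : ℝ)
    (hJ : ∀ χ, ‖u χ‖ ≤ C * ‖J χ‖) : ∃ ut : B →L[ℂ] ℂ, ∀ χ, ut (J χ) = u χ := by
  obtain ⟨ut, hut, -⟩ := exists_extension_norm_eq (LinearMap.range J) (u.compLeftInverse J)
  refine ⟨ut, fun χ => ?_⟩
  have := hut ⟨J χ, ⟨χ, rfl⟩⟩
  rw [LinearMap.compLeftInverse_apply_of_bdd _ _ ⟨C, hJ⟩ χ _ rfl] at this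
  exact this

variable {E : Type} [NormedAddCommGroup E] [NormedSpace ℝ E]

/-- Bounded continuous functions with values in multilinear maps. -/
def WB (E : Type) [NormedAddCommGroup E] [NormedSpace ℝ E] (l : ℕ) : Type :=
  E →ᵇ (E [×l]→L[ℝ] ℂ)

noncomputable instance (l : ℕ) : NormedAddCommGroup (WB E l) :=
  inferInstanceAs (NormedAddCommGroup (E →ᵇ (E [×l]→L[ℝ] ℂ)))

noncomputable instance (l : ℕ) : NormedSpace ℂ (WB E l) :=
  inferInstanceAs (NormedSpace ℂ (E →ᵇ (E [×l]→L[ℝ] ℂ)))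

instance (l : ℕ) : CompleteSpace (WB E l) :=
  inferInstanceAs (CompleteSpace (E →ᵇ (E [×l]→L[ℝ] ℂ)))

/-- Evaluation at a point. -/
noncomputable def WB.ev (l : ℕ) (y : E) : WB E l →L[ℂ] (E [×l]→L[ℝ] ℂ) :=
  (BoundedContinuousFunction.evalCLM ℂ y : (E →ᵇ (E [×l]→L[ℝ] ℂ)) →L[ℂ] (E [×l]→L[ℝ] ℂ))

theorem WB.norm_le {l : ℕ} (f : WB E l) {C : ℝ} (hC : 0 ≤ C) (h : ∀ y, ‖WB.ev l y f‖ ≤ C) :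
    ‖f‖ ≤ C :=
  (BoundedContinuousFunction.norm_le (f := (f : E →ᵇ (E [×l]→L[ℝ] ℂ))) hC).2 h

theorem WB.norm_ev_le {l : ℕ} (f : WB E l) (y : E) : ‖WB.ev l y f‖ ≤ ‖f‖ :=
  BoundedContinuousFunction.norm_coe_le_norm (f : E →ᵇ (E [×l]→L[ℝ] ℂ)) y

theorem WB.ext {l : ℕ} (f g : WB E l) (h : ∀ y, WB.ev l y f = WB.ev l y g) : f = g :=
  BoundedContinuousFunction.ext (f := (f : E →ᵇ (E [×l]→L[ℝ] ℂ))) h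

/-- One weighted derivative of a Schwartz function as a bounded continuous function. -/
noncomputable def wder0 (k l : ℕ) : 𝓢(E, ℂ) →ₗ[ℂ] (E →ᵇ (E [×l]→L[ℝ] ℂ)) where
  toFun χ := BoundedContinuousFunction.ofNormedAddCommGroup
    (fun y => (‖y‖ ^ k) • iteratedFDeriv ℝ l χ y)
    ((continuous_norm.pow k).smul ((χ.smooth ⊤).continuous_iteratedFDeriv
      (by exact_mod_cast le_top)))
    (SchwartzMap.seminorm ℝ k l χ)
    (fun y => by
      rw [norm_smul, norm_pow, norm_norm]
      exact SchwartzMap.le_seminorm ℝ k l χ y)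
  map_add' χ ψ := by
    ext1 y
    have : iteratedFDeriv ℝ l (χ + ψ) y = iteratedFDeriv ℝ l χ y + iteratedFDeriv ℝ l ψ y :=
      iteratedFDeriv_add_apply (χ.smooth l).contDiffAt (ψ.smooth l).contDiffAt
    show (‖y‖ ^ k) • iteratedFDeriv ℝ l (χ + ψ) y = (‖y‖ ^ k) • iteratedFDeriv ℝ l χ y +
      (‖y‖ ^ k) • iteratedFDeriv ℝ l ψ y
    rw [this, smul_add]
  map_smul' c χ := by
    ext1 y
    have : iteratedFDeriv ℝ l (c • ⇑χ) y = c • iteratedFDeriv ℝ l χ y :=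
      iteratedFDeriv_const_smul_apply (χ.smooth l).contDiffAt
    show (‖y‖ ^ k) • iteratedFDeriv ℝ l (c • ⇑χ) y = c • ((‖y‖ ^ k) • iteratedFDeriv ℝ l χ y)
    rw [this, smul_comm]

/-- One weighted derivative. -/
noncomputable def wder (k l : ℕ) : 𝓢(E, ℂ) →ₗ[ℂ] WB E l := wder0 k l

theorem wder_apply (k l : ℕ) (χ : 𝓢(E, ℂ)) (y : E) :
    WB.ev l y (wder k l χ) = (‖y‖ ^ k) • iteratedFDeriv ℝ l χ y := rfl

theorem seminorm_le_wder (k l : ℕ) (χ : 𝓢(E, ℂ)) :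
    SchwartzMap.seminorm ℂ k l χ ≤ ‖wder k l χ‖ := by
  refine SchwartzMap.seminorm_le_bound ℂ k l χ (norm_nonneg (wder k l χ)) fun y => ?_
  have := WB.norm_ev_le (wder k l χ) y
  rwa [wder_apply, norm_smul, norm_pow, norm_norm] at this

/-- Finitely many weighted derivatives. -/
noncomputable def wders (s : Finset (ℕ × ℕ)) :
    𝓢(E, ℂ) →ₗ[ℂ] (∀ i : s, WB E i.1.2) :=
  LinearMap.pi fun i => wder i.1.1 i.1.2

theorem wders_apply (s : Finset (ℕ × ℕ)) (χ : 𝓢(E, ℂ)) (i : s) :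
    wders s χ i = wder i.1.1 i.1.2 χ := rfl

variable [MeasurableSpace E] [BorelSpace E] [FiniteDimensional ℝ E]
  (μ : Measure E) [μ.HasTemperateGrowth]

theorem interchange (F : 𝓢(E × E, ℂ)) (Φ : 𝓢(E, ℂ)) (A : E → 𝓢(E, ℂ))
    (hA : ∀ z y, A z y = F (z, y)) (hΦ : ∀ y, Φ y = ∫ z, F (z, y) ∂μ)
    (u : 𝓢(E, ℂ) →L[ℂ] ℂ) : u Φ = ∫ z, u (A z) ∂μ := by
  have hA' : ∀ z, (A z : E → ℂ) = fun y => F (z, y) := fun z => funext (hA z)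
  have hΦ' : (Φ : E → ℂ) = fun y => ∫ z, F (z, y) ∂μ := funext hΦ
  obtain ⟨s, C, -, hC⟩ := Seminorm.bound_of_continuous (schwartz_withSeminorms ℂ E ℂ)
    ((normSeminorm ℂ ℂ).comp u.toLinearMap) (by
      show Continuous fun x => ‖u x‖
      fun_prop)
  set J : 𝓢(E, ℂ) →ₗ[ℂ] (∀ i : s, WB E i.1.2) := wders s with hJdef
  have hJ : ∀ χ, ‖u χ‖ ≤ C * ‖J χ‖ := by
    intro χ
    refine (hC χ).trans ?_
    show (C : ℝ) * (s.sup (schwartzSeminormFamily ℂ E ℂ)) χ ≤ _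
    gcongr
    refine Seminorm.finset_sup_apply_le (norm_nonneg _) fun i hi => ?_
    refine (seminorm_le_wder i.1 i.2 χ).trans ?_
    exact norm_le_pi_norm (J χ) ⟨i, hi⟩
  obtain ⟨ut, hut'⟩ := exists_factor (B := ∀ i : s, WB E i.1.2) J u.toLinearMap C hJ
  have hut' : ∀ χ, ut (J χ) = u χ := hut'
  have hcont : Continuous fun z => J (A z) := by
    refine continuous_pi fun i => ?_
    refine (LipschitzWith.of_dist_le_mul (K := Real.toNNReal (SchwartzMap.seminorm ℝ i.1.1 (i.1.2 + 1) F)) ?_).continuous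
    intro z z'
    rw [dist_eq_norm, dist_eq_norm, Real.coe_toNNReal _ (apply_nonneg _ _)]
    refine WB.norm_le _ (by positivity) fun y => ?_
    rw [map_sub, wders_apply, wders_apply, wder_apply, wder_apply]
    rw [hA', hA']
    exact (aux_smul_sub (‖y‖ ^ i.1.1) (by positivity) _ _).le.trans (slice_lip F _ _ _ _ _)
  have hbd : ∀ n : ℕ, ∀ z, ‖z‖ ^ n * ‖J (A z)‖ ≤
      ∑ i ∈ s, SchwartzMap.seminorm ℝ (n + i.1) i.2 F := by
    intro n z
    have h0 : 0 ≤ ∑ i ∈ s, SchwartzMap.seminorm ℝ (n + i.1) i.2 F :=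
      Finset.sum_nonneg fun _ _ => apply_nonneg _ _
    have : ‖z‖ ^ n * ‖J (A z)‖ = ‖((‖z‖ ^ n : ℝ) : ℂ) • J (A z)‖ := by
      rw [norm_smul]; simp
    rw [this, pi_norm_le_iff_of_nonneg h0]
    intro i
    refine WB.norm_le _ h0 fun y => ?_
    rw [Pi.smul_apply, map_smul, wders_apply, wder_apply]
    rw [norm_smul, norm_smul, norm_pow, norm_norm, hA']
    have h2 := slice_bound F n i.1.1 i.1.2 z y
    refine le_trans ?_ (h2.trans (Finset.single_le_sum (f := fun i : ℕ × ℕ => SchwartzMap.seminorm ℝ (n + i.1) i.2 F)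
      (fun _ _ => apply_nonneg _ _) i.2))
    simp
  have hIntg : Integrable (fun z => J (A z)) μ := by
    have h := integrable_of_le_of_pow_mul_le (μ := μ) (k := 0) (f := fun z => J (A z))
      (C₁ := ∑ i ∈ s, SchwartzMap.seminorm ℝ (0 + i.1) i.2 F)
      (C₂ := ∑ i ∈ s, SchwartzMap.seminorm ℝ (0 + μ.integrablePower + i.1) i.2 F)
      (fun z => by simpa using hbd 0 z) (fun z => hbd _ z) hcont.aestronglyMeasurable
    simp only [pow_zero, one_mul] at h
    exact (integrable_norm_iff hcont.aestronglyMeasurable).1 h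
  have hJΦ : J Φ = ∫ z, J (A z) ∂μ := by
    funext i
    refine WB.ext _ _ fun y => ?_
    let ev : (∀ i : s, WB E i.1.2) →L[ℂ] (E [×i.1.2]→L[ℝ] ℂ) :=
      (WB.ev i.1.2 y).comp (ContinuousLinearMap.proj i)
    have h1 : WB.ev i.1.2 y ((∫ z, J (A z) ∂μ) i) = ∫ z, WB.ev i.1.2 y ((J (A z)) i) ∂μ :=
      (ev.integral_comp_comm hIntg).symm
    rw [h1]
    show (‖y‖ ^ i.1.1) • iteratedFDeriv ℝ i.1.2 Φ y =
      ∫ z, (‖y‖ ^ i.1.1) • iteratedFDeriv ℝ i.1.2 (A z) y ∂μ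
    rw [integral_smul, hΦ', iter_integral μ i.1.2 F y]
    simp only [hA']
  rw [← hut', hJΦ, ← ut.integral_comp_comm hIntg]
  simp only [hut']

end Interchange2
end TFInv


namespace TFInv
open scoped SchwartzMap ContDiff
section Tensor
variable {E : Type} [NormedAddCommGroup E] [NormedSpace ℝ E]

theorem norm_iter_comp {D : Type} [NormedAddCommGroup D] [NormedSpace ℝ D] (m : 𝓢(E, ℂ))
    (P : D →L[ℝ] E) (hP : ‖P‖ ≤ 1) (i : ℕ) (p : D) :
    ‖iteratedFDeriv ℝ i (fun p => m (P p)) p‖ ≤ ‖iteratedFDeriv ℝ i m (P p)‖ := by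
  have h := ContinuousLinearMap.iteratedFDeriv_comp_right P (m.smooth ⊤) p (i := i)
    (by exact_mod_cast le_top)
  have h2 : (fun p => m (P p)) = m ∘ P := rfl
  rw [h2, h]
  refine (ContinuousMultilinearMap.norm_compContinuousLinearMap_le _ _).trans ?_
  refine mul_le_of_le_one_right (norm_nonneg _) ?_
  exact Finset.prod_le_one (fun _ _ => norm_nonneg _) (fun _ _ => hP)

/-- Tensor product of two Schwartz functions. -/
noncomputable def tensor (m φ : 𝓢(E, ℂ)) : 𝓢(E × E, ℂ) where
  toFun p := m p.1 * φ p.2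
  smooth' := ((m.smooth ⊤).comp contDiff_fst).mul ((φ.smooth ⊤).comp contDiff_snd)
  decay' := by
    intro k n
    let pm : ℕ → ℕ → ℝ := fun k l => SchwartzMap.seminorm ℝ k l m
    let pf : ℕ → ℕ → ℝ := fun k l => SchwartzMap.seminorm ℝ k l φ
    refine ⟨∑ i ∈ Finset.range (n + 1), (n.choose i : ℝ) *
      (pm k i * pf 0 (n - i) + pm 0 i * pf k (n - i)), fun p => ?_⟩
    have h := norm_iteratedFDeriv_mul_le (𝕜 := ℝ) (f := fun p : E × E => m p.1)
      (g := fun p : E × E => φ p.2) (N := ∞) ((m.smooth ⊤).comp contDiff_fst)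
      ((φ.smooth ⊤).comp contDiff_snd) p (n := n) (by exact_mod_cast le_top)
    refine (mul_le_mul_of_nonneg_left h (by positivity)).trans ?_
    rw [Finset.mul_sum]
    refine Finset.sum_le_sum fun i _ => ?_
    have h1 := norm_iter_comp m (ContinuousLinearMap.fst ℝ E E)
      (ContinuousLinearMap.norm_fst_le ℝ E E) i p
    have h2 := norm_iter_comp φ (ContinuousLinearMap.snd ℝ E E)
      (ContinuousLinearMap.norm_snd_le ℝ E E) (n - i) p
    simp only [ContinuousLinearMap.coe_fst', ContinuousLinearMap.coe_snd'] at h1 h2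
    have a1 := SchwartzMap.le_seminorm ℝ k i m p.1
    have a2 := SchwartzMap.le_seminorm ℝ 0 i m p.1
    have b1 := SchwartzMap.le_seminorm ℝ k (n - i) φ p.2
    have b2 := SchwartzMap.le_seminorm ℝ 0 (n - i) φ p.2
    rw [pow_zero, one_mul] at a2 b2
    have hp : ‖p‖ ^ k ≤ ‖p.1‖ ^ k + ‖p.2‖ ^ k := by
      rw [Prod.norm_def]
      rcases max_cases ‖p.1‖ ‖p.2‖ with h | h <;> rw [h.1] <;> 
        nlinarith [pow_nonneg (norm_nonneg p.1) k, pow_nonneg (norm_nonneg p.2) k]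
    set x := ‖iteratedFDeriv ℝ i m p.1‖
    set y := ‖iteratedFDeriv ℝ (n - i) φ p.2‖
    have hx : 0 ≤ x := norm_nonneg _
    have hy : 0 ≤ y := norm_nonneg _
    calc _ ≤ (‖p.1‖ ^ k + ‖p.2‖ ^ k) * ((n.choose i : ℝ) * x * y) := by gcongr
      _ = (n.choose i : ℝ) * ((‖p.1‖ ^ k * x) * y + x * (‖p.2‖ ^ k * y)) := by ring
      _ ≤ _ := by
        gcongr

theorem tensor_apply (m φ : 𝓢(E, ℂ)) (p : E × E) : tensor m φ p = m p.1 * φ p.2 := rfl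

theorem iteratedDeriv_exp (a : ℂ) (n : ℕ) :
    iteratedDeriv n (fun t : ℝ => Complex.exp (a * t)) = fun t : ℝ => a ^ n * Complex.exp (a * t) := by
  induction n with
  | zero => simp
  | succ n ih =>
    rw [iteratedDeriv_succ, ih]
    funext t
    have h1 : HasDerivAt (fun t : ℝ => a * (t : ℂ)) (a * 1) t :=
      (Complex.ofRealCLM.hasDerivAt (x := t)).const_mul a
    have := (h1.cexp.const_mul (a ^ n)).deriv
    rw [this]; ring

theorem exp_temperate : (fun t : ℝ => Complex.exp (Complex.I * t)).HasTemperateGrowth := by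
  refine ⟨?_, fun n => ⟨0, 1, fun t => ?_⟩⟩
  · exact Complex.contDiff_exp.comp (contDiff_const.mul Complex.ofRealCLM.contDiff)
  · rw [norm_iteratedFDeriv_eq_norm_iteratedDeriv, iteratedDeriv_exp]
    simp [mul_comm Complex.I, Complex.norm_exp_ofReal_mul_I]

end Tensor
section Lemmas
variable {E : Type} [NormedAddCommGroup E] [InnerProductSpace ℝ E]
  [MeasurableSpace E] [BorelSpace E] [FiniteDimensional ℝ E]
  (μ : Measure E) [μ.HasTemperateGrowth]

theorem phase_temperate (c : ℝ) :
    (fun p : E × E => Complex.exp (Complex.I * ((c * inner ℝ p.2 p.1 : ℝ) : ℂ))).HasTemperateGrowth := by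
  have h1 : (fun p : E × E => c * inner ℝ p.2 p.1).HasTemperateGrowth :=
    (Function.HasTemperateGrowth.const c).mul
      ((innerSL ℝ : E →L[ℝ] E →L[ℝ] ℝ).bilinear_hasTemperateGrowth
        (ContinuousLinearMap.snd ℝ E E).hasTemperateGrowth
        (ContinuousLinearMap.fst ℝ E E).hasTemperateGrowth)
  exact exp_temperate.comp h1

theorem lemma_M (m φ : 𝓢(E, ℂ)) (c : ℝ) (A : E → 𝓢(E, ℂ))
    (hA : ∀ ξ y, A ξ y = Complex.exp (Complex.I * ((c * inner ℝ y ξ : ℝ) : ℂ)) * φ y)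
    (Φ : 𝓢(E, ℂ))
    (hΦ : ∀ y, Φ y = (∫ ξ, m ξ * Complex.exp (Complex.I * ((c * inner ℝ y ξ : ℝ) : ℂ)) ∂μ) * φ y)
    (u : 𝓢(E, ℂ) →L[ℂ] ℂ) : u Φ = ∫ ξ, m ξ * u (A ξ) ∂μ := by
  have := interchange μ (SchwartzMap.smulLeftCLM ℂ
    (fun p : E × E => Complex.exp (Complex.I * ((c * inner ℝ p.2 p.1 : ℝ) : ℂ))) (tensor m φ))
    Φ (fun ξ => m ξ • A ξ) ?_ ?_ u
  · simpa using this
  · intro z y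
    rw [SchwartzMap.smulLeftCLM_apply_apply (phase_temperate c), tensor_apply,
      SchwartzMap.smul_apply, hA]
    simp only [smul_eq_mul]; ring
  · intro y
    rw [hΦ, ← integral_mul_const]
    congr 1; funext z
    rw [SchwartzMap.smulLeftCLM_apply_apply (phase_temperate c), tensor_apply]
    simp only [smul_eq_mul]; ring

/-- The shear map. -/
noncomputable def shear : (E × E) ≃L[ℝ] (E × E) :=
  ContinuousLinearEquiv.equivOfInverse
    ((ContinuousLinearMap.fst ℝ E E + ContinuousLinearMap.snd ℝ E E).prod
      (ContinuousLinearMap.snd ℝ E E))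
    ((ContinuousLinearMap.fst ℝ E E - ContinuousLinearMap.snd ℝ E E).prod
      (ContinuousLinearMap.snd ℝ E E))
    (fun p => by simp) (fun p => by simp)

theorem lemma_T [μ.IsAddHaarMeasure] (a φ : 𝓢(E, ℂ)) (A : E → 𝓢(E, ℂ))
    (hA : ∀ x y, A x y = a (y + x) * φ y)
    (u : 𝓢(E, ℂ) →L[ℂ] ℂ) : (∫ x, a x ∂μ) * u φ = ∫ x, u (A x) ∂μ := by
  have := interchange μ (SchwartzMap.compCLMOfContinuousLinearEquiv ℂ (shear (E := E)) (tensor a φ))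
    ((∫ x, a x ∂μ) • φ) A ?_ ?_ u
  · simpa using this
  · intro z y
    rw [hA, SchwartzMap.compCLMOfContinuousLinearEquiv_apply]
    simp [shear, tensor_apply, add_comm]
  · intro y
    rw [SchwartzMap.smul_apply, ← integral_add_right_eq_self _ y, smul_eq_mul, ← integral_mul_const]
    congr 1
end Lemmas
end TFInv


namespace TFInv
section Mean
variable {G : Type*} [AddCommGroup G]

/-- `c` bounds some average of translates of `F`. -/
def Adm (F : G → ℝ) (c : ℝ) : Prop :=
  ∃ n : ℕ, 0 < n ∧ ∃ g : Fin n → G, ∀ x, ∑ i, F (x + g i) ≤ n * c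

theorem Adm.of_fintype {F : G → ℝ} {c : ℝ} {ι : Type*} [Fintype ι] [Nonempty ι] (g : ι → G)
    (h : ∀ x, ∑ i, F (x + g i) ≤ Fintype.card ι * c) : Adm F c := by
  refine ⟨Fintype.card ι, Fintype.card_pos, fun i => g ((Fintype.equivFin ι).symm i), fun x => ?_⟩
  refine le_trans (le_of_eq ?_) (h x)
  exact Equiv.sum_comp (Fintype.equivFin ι).symm (fun i => F (x + g i))

theorem Adm.add {F H : G → ℝ} {c c' : ℝ} (hF : Adm F c) (hH : Adm H c') :
    Adm (F + H) (c + c') := by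
  obtain ⟨n, hn, g, hg⟩ := hF
  obtain ⟨k, hk, h, hh⟩ := hH
  have : Nonempty (Fin n × Fin k) := ⟨(⟨0, hn⟩, ⟨0, hk⟩)⟩
  refine Adm.of_fintype (ι := Fin n × Fin k) (fun p => g p.1 + h p.2) fun x => ?_
  simp only [Pi.add_apply, Finset.sum_add_distrib, Fintype.card_prod, Fintype.card_fin]
  have h1 : ∑ p : Fin n × Fin k, F (x + (g p.1 + h p.2)) ≤ k * (n * c) := by
    rw [Fintype.sum_prod_type_right]
    refine (Finset.sum_le_sum fun j _ => ?_).trans_eq (b := ∑ j : Fin k, (n * c : ℝ)) ?_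
    · refine le_trans (le_of_eq ?_) (hg (x + h j))
      refine Finset.sum_congr rfl fun i _ => ?_
      congr 1; abel
    · simp
  have h2 : ∑ p : Fin n × Fin k, H (x + (g p.1 + h p.2)) ≤ n * (k * c') := by
    rw [Fintype.sum_prod_type]
    refine (Finset.sum_le_sum fun i _ => ?_).trans_eq (b := ∑ j : Fin n, (k * c' : ℝ)) ?_
    · refine le_trans (le_of_eq ?_) (hh (x + g i))
      refine Finset.sum_congr rfl fun j _ => ?_
      congr 1; abel
    · simp
  push_cast
  linarith

theorem Adm.smul {F : G → ℝ} {c t : ℝ} (ht : 0 < t) (hF : Adm F c) : Adm (t • F) (t * c) := by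
  obtain ⟨n, hn, g, hg⟩ := hF
  refine ⟨n, hn, g, fun x => ?_⟩
  simp only [Pi.smul_apply, smul_eq_mul, ← Finset.mul_sum]
  nlinarith [hg x]

theorem Adm.lower {F : G → ℝ} {c K : ℝ} (hK : ∀ x, K ≤ F x) (hF : Adm F c) : K ≤ c := by
  obtain ⟨n, hn, g, hg⟩ := hF
  have h1 : (n : ℝ) * K ≤ ∑ i, F (0 + g i) := by
    refine le_trans (le_of_eq ?_) (Finset.sum_le_sum fun i _ => hK (0 + g i))
    simp
  have hn' : (0 : ℝ) < n := by exact_mod_cast hn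
  exact le_of_mul_le_mul_left (h1.trans (hg 0)) hn'

theorem Adm.of_le {F : G → ℝ} {c : ℝ} (h : ∀ x, F x ≤ c) : Adm F c :=
  ⟨1, one_pos, fun _ => 0, fun x => by simpa using h x⟩

theorem Adm.shift {F : G → ℝ} {K : ℝ} (hK : ∀ x, |F x| ≤ K) (w : G) {ε : ℝ} (hε : 0 < ε) :
    Adm (fun x => F (x + w) - F x) ε := by
  obtain ⟨n, hn⟩ := exists_nat_gt (2 * K / ε)
  have hK0 : 0 ≤ K := (abs_nonneg _).trans (hK 0)
  have hn0 : (0 : ℝ) < n := lt_of_le_of_lt (by positivity) hn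
  refine ⟨n, by exact_mod_cast hn0, fun i => (i : ℕ) • w, fun x => ?_⟩
  rw [Fin.sum_univ_eq_sum_range (fun i => F (x + i • w + w) - F (x + i • w)) n]
  have : ∀ i : ℕ, F (x + i • w + w) - F (x + i • w) =
      (fun i : ℕ => F (x + i • w)) (i + 1) - (fun i : ℕ => F (x + i • w)) i := by
    intro i; simp [succ_nsmul, add_assoc]
  simp only [this]
  rw [Finset.sum_range_sub (fun i : ℕ => F (x + i • w)) n]
  rw [div_lt_iff₀ hε] at hn
  have a := abs_le.1 (hK (x + n • w))
  have b := abs_le.1 (hK (x + 0 • w))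
  linarith [a.2, b.1]

variable (G) in
/-- Bounded functions. -/
def Bdd : Submodule ℝ (G → ℝ) where
  carrier := {F | ∃ K, ∀ x, |F x| ≤ K}
  zero_mem' := ⟨0, by simp⟩
  add_mem' := by
    rintro F H ⟨K, hK⟩ ⟨L, hL⟩
    exact ⟨K + L, fun x => (abs_add_le _ _).trans (add_le_add (hK x) (hL x))⟩
  smul_mem' := by
    rintro t F ⟨K, hK⟩
    refine ⟨|t| * K, fun x => ?_⟩
    simp only [Pi.smul_apply, smul_eq_mul, abs_mul]
    exact mul_le_mul_of_nonneg_left (hK x) (abs_nonneg _)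

/-- The sublinear functional. -/
noncomputable def pm (F : G → ℝ) : ℝ := sInf {c | Adm F c}

theorem pm_le {F : G → ℝ} (hF : F ∈ Bdd G) {c : ℝ} (h : Adm F c) : pm F ≤ c := by
  obtain ⟨K, hK⟩ := hF
  exact csInf_le ⟨-K, fun c hc => Adm.lower (fun x => (abs_le.1 (hK x)).1) hc⟩ h

theorem le_pm {F : G → ℝ} (hF : F ∈ Bdd G) {b : ℝ} (h : ∀ c, Adm F c → b ≤ c) : b ≤ pm F := by
  obtain ⟨K, hK⟩ := hF
  exact le_csInf ⟨K, Adm.of_le fun x => (abs_le.1 (hK x)).2⟩ h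

theorem pm_smul_le {F : G → ℝ} (hF : F ∈ Bdd G) {t : ℝ} (ht : 0 < t) : pm (t • F) ≤ t * pm F := by
  have : pm (t • F) / t ≤ pm F := le_pm hF fun c hc => by
    rw [div_le_iff₀ ht, mul_comm]
    exact pm_le ((Bdd G).smul_mem t hF) (hc.smul ht)
  rw [div_le_iff₀ ht] at this
  linarith

theorem exists_mean (G : Type*) [AddCommGroup G] : ∃ m : (G → ℝ) →ₗ[ℝ] ℝ,
    (∀ (F : G → ℝ) (K : ℝ) (w : G), (∀ x, |F x| ≤ K) → m (fun x => F (x + w)) = m F) ∧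
    (∀ (F : G → ℝ) (K c : ℝ), (∀ x, |F x| ≤ K) → (∀ x, F x ≤ c) → m F ≤ c) := by
  obtain ⟨m0, -, hm0⟩ := exists_extension_of_le_sublinear (E := Bdd G) ⟨⊥, 0⟩ (fun F => pm F.1)
    (by
      intro t ht F
      refine le_antisymm (pm_smul_le F.2 ht) ?_
      have h := pm_smul_le ((Bdd G).smul_mem t F.2) (inv_pos.2 ht)
      rw [inv_smul_smul₀ ht.ne'] at h
      rw [le_inv_mul_iff₀ ht] at h
      exact h)
    (by
      intro F H
      have h1 : pm (F + H).1 - pm H.1 ≤ pm F.1 := le_pm F.2 fun c hc => by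
        have : pm (F + H).1 - c ≤ pm H.1 := le_pm H.2 fun c' hc' => by
          have := pm_le (F + H).2 (hc.add hc')
          linarith
        linarith
      linarith)
    (by
      rintro ⟨x, hx⟩
      have hx0 : x = 0 := by simpa using hx
      subst hx0
      have : (0 : ℝ) ≤ pm (G := G) (0 : G → ℝ) := le_pm (Bdd G).zero_mem fun c hc => hc.lower (by simp)
      simpa using this)
  obtain ⟨m, hm⟩ := LinearMap.exists_extend m0
  have hmm : ∀ F (hF : F ∈ Bdd G), m F = m0 ⟨F, hF⟩ := fun F hF => by
    rw [← hm]; rfl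
  have hle : ∀ F (hF : F ∈ Bdd G) c, Adm F c → m F ≤ c := fun F hF c hc => by
    rw [hmm F hF]; exact (hm0 _).trans (pm_le hF hc)
  refine ⟨m, fun F K w hK => ?_, fun F K c hK hc => hle F ⟨K, hK⟩ c (Adm.of_le hc)⟩
  have key : ∀ (H : G → ℝ), (∀ x, |H x| ≤ K) → m (fun x => H (x + w)) ≤ m H := by
    intro H hH
    have h0 : (fun x => H (x + w) - H x) = (fun x => H (x + w)) - H := rfl
    have hb : (fun x => H (x + w) - H x) ∈ Bdd G :=
      (Bdd G).sub_mem ⟨K, fun x => hH (x + w)⟩ ⟨K, hH⟩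
    have h1 : m (fun x => H (x + w) - H x) ≤ 0 :=
      le_of_forall_pos_le_add fun ε hε => by
        rw [zero_add]; exact hle _ hb _ (Adm.shift hH w hε)
    rw [h0, map_sub] at h1
    linarith
  refine le_antisymm (key F hK) ?_
  have h2 := key (-F) (by simpa using hK)
  have h3 : (fun x => (-F) (x + w)) = -(fun x => F (x + w)) := rfl
  rw [h3, map_neg, map_neg] at h2
  linarith

theorem exists_cmean (G : Type*) [AddCommGroup G] : ∃ M : (G → ℂ) →ₗ[ℂ] ℂ,
    (∀ (F : G → ℂ) (K : ℝ) (w : G), (∀ x, ‖F x‖ ≤ K) → M (fun x => F (x + w)) = M F) ∧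
    (∀ F : G → ℂ, M (fun x => star (F x)) = star (M F)) ∧
    (∀ (F : G → ℂ) (K : ℝ), (∀ x, ‖F x‖ ≤ K) → ‖M F‖ ≤ 2 * K) ∧
    (∀ (F : G → ℂ) (K c : ℝ), (∀ x, ‖F x‖ ≤ K) → (∀ x, (F x).re ≤ c) → (M F).re ≤ c) ∧
    (∀ (F : G → ℂ) (K c : ℝ), (∀ x, ‖F x‖ ≤ K) → (∀ x, c ≤ (F x).re) → c ≤ (M F).re) := by
  obtain ⟨m, h1, h2⟩ := exists_mean G
  have h3 : ∀ (F : G → ℝ) (K c : ℝ), (∀ x, |F x| ≤ K) → (∀ x, c ≤ F x) → c ≤ m F := by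
    intro F K c hK hc
    have := h2 (-F) K (-c) (by simpa using hK) (by simpa using hc)
    rw [map_neg] at this; linarith
  have h4 : ∀ (F : G → ℝ) (K : ℝ), (∀ x, |F x| ≤ K) → |m F| ≤ K := fun F K hK =>
    abs_le.2 ⟨h3 F K _ hK fun x => (abs_le.1 (hK x)).1, h2 F K _ hK fun x => (abs_le.1 (hK x)).2⟩
  let M : (G → ℂ) →ₗ[ℂ] ℂ :=
    { toFun := fun F => (m (fun x => (F x).re) : ℂ) + (m (fun x => (F x).im) : ℂ) * Complex.I
      map_add' := fun F H => by
        have a : (fun x => ((F + H) x).re) = (fun x => (F x).re) + fun x => (H x).re := rfl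
        have b : (fun x => ((F + H) x).im) = (fun x => (F x).im) + fun x => (H x).im := rfl
        rw [a, b, map_add, map_add]; push_cast; ring
      map_smul' := fun t F => by
        have a : (fun x => ((t • F) x).re) = t.re • (fun x => (F x).re) - t.im • fun x => (F x).im := by
          funext x; simp
        have b : (fun x => ((t • F) x).im) = t.re • (fun x => (F x).im) + t.im • fun x => (F x).re := by
          funext x; simp
        rw [a, b, map_add, map_sub, map_smul, map_smul, map_smul, map_smul]
        apply Complex.ext <;> simp }
  have hre : ∀ F, (M F).re = m (fun x => (F x).re) := fun F => by simp [M]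
  have him : ∀ F, (M F).im = m (fun x => (F x).im) := fun F => by simp [M]
  have kre : ∀ (F : G → ℂ) (K : ℝ), (∀ x, ‖F x‖ ≤ K) → ∀ x, |(F x).re| ≤ K := fun F K h x =>
    (Complex.abs_re_le_norm _).trans (h x)
  have kim : ∀ (F : G → ℂ) (K : ℝ), (∀ x, ‖F x‖ ≤ K) → ∀ x, |(F x).im| ≤ K := fun F K h x =>
    (Complex.abs_im_le_norm _).trans (h x)
  refine ⟨M, fun F K w hK => ?_, fun F => ?_, fun F K hK => ?_, fun F K c hK hc => ?_,
    fun F K c hK hc => ?_⟩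
  · apply Complex.ext
    · rw [hre, hre]; exact h1 _ K w (kre F K hK)
    · rw [him, him]; exact h1 _ K w (kim F K hK)
  · apply Complex.ext
    · rw [hre]; simp [hre]
    · rw [him]
      have : (fun x => (star (F x)).im) = -(fun x => (F x).im) := by funext x; simp
      rw [this, map_neg]; simp [him]
  · refine (Complex.norm_le_abs_re_add_abs_im _).trans ?_
    rw [hre, him, two_mul]
    exact add_le_add (h4 _ K (kre F K hK)) (h4 _ K (kim F K hK))
  · rw [hre]; exact h2 _ K c (kre F K hK) hc
  · rw [hre]; exact h3 _ K c (kre F K hK) hc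
end Mean
end TFInv


namespace TFInv
open scoped SchwartzMap
section Form
variable {d : ℕ} {X : Type*} [NormedAddCommGroup X] [InnerProductSpace ℂ X] [CompleteSpace X]

theorem exists_J
    (j : X →L[ℂ] WeakDual ℂ (SchwartzMap (EuclideanSpace ℝ (Fin d)) ℂ)) :
    ∃ J : 𝓢(EuclideanSpace ℝ (Fin d), ℂ) → X, ∀ φ f, inner ℂ (J φ) f = j f φ := by
  refine ⟨fun φ => (InnerProductSpace.toDual ℂ X).symm
    ⟨{ toFun := fun f => j f φ
       map_add' := fun f g => by rw [map_add]; rfl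
       map_smul' := fun c f => by rw [map_smul]; rfl },
      (WeakDual.eval_continuous φ).comp j.continuous⟩, fun φ f => ?_⟩
  rw [InnerProductSpace.toDual_symm_apply]
  rfl

theorem exists_u
    (j : X →L[ℂ] WeakDual ℂ (SchwartzMap (EuclideanSpace ℝ (Fin d)) ℂ)) (g : X) :
    ∃ u : 𝓢(EuclideanSpace ℝ (Fin d), ℂ) →L[ℂ] ℂ, ∀ φ, u φ = j g φ :=
  ⟨j g, fun _ => rfl⟩

theorem exists_form
    (j : X →L[ℂ] WeakDual ℂ (SchwartzMap (EuclideanSpace ℝ (Fin d)) ℂ))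
    (S : EuclideanSpace ℝ (Fin d) → EuclideanSpace ℝ (Fin d) →
      (SchwartzMap (EuclideanSpace ℝ (Fin d)) ℂ →L[ℂ] SchwartzMap (EuclideanSpace ℝ (Fin d)) ℂ))
    (hS : ∀ (x ξ : EuclideanSpace ℝ (Fin d)) (φ : SchwartzMap (EuclideanSpace ℝ (Fin d)) ℂ)
        (z : EuclideanSpace ℝ (Fin d)),
        S x ξ φ z = Complex.exp (Complex.I * ((inner ℝ z ξ + inner ℝ x ξ : ℝ) : ℂ)) * φ (z + x))
    (C₀ : ℝ) (hC₀ : 0 < C₀)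
    (hshift : ∀ (f : X) (x ξ : EuclideanSpace ℝ (Fin d)),
        ∃ f' : X, (∀ φ, j f' φ = j f (S x ξ φ)) ∧ ‖f'‖ ≤ C₀ * ‖f‖)
    (J : 𝓢(EuclideanSpace ℝ (Fin d), ℂ) → X) (hJ : ∀ φ f, inner ℂ (J φ) f = j f φ) :
    ∃ B : 𝓢(EuclideanSpace ℝ (Fin d), ℂ) → 𝓢(EuclideanSpace ℝ (Fin d), ℂ) → ℂ,
      (∀ χ, ∃ u : 𝓢(EuclideanSpace ℝ (Fin d), ℂ) →L[ℂ] ℂ, ∀ φ, B φ χ = u φ) ∧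
      (∀ φ χ, B χ φ = star (B φ χ)) ∧
      (∀ x ξ φ χ, B (S x ξ φ) (S x ξ χ) = B φ χ) ∧
      (∀ φ, (C₀ ^ 2)⁻¹ * ‖J φ‖ ^ 2 ≤ (B φ φ).re ∧ (B φ φ).re ≤ C₀ ^ 2 * ‖J φ‖ ^ 2) := by
  have hJs : ∀ (c : ℂ) φ, J (c • φ) = star c • J φ := by
    intro c φ
    refine ext_inner_right ℂ fun f => ?_
    rw [inner_smul_left, hJ, hJ]
    simp
  have hcomp : ∀ x ξ x' ξ' φ, S x ξ (S x' ξ' φ) =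
      Complex.exp (Complex.I * ((- inner ℝ x' ξ : ℝ) : ℂ)) • S (x + x') (ξ + ξ') φ := by
    intro x ξ x' ξ' φ
    ext y
    rw [smul_apply, hS, hS, hS, smul_eq_mul, ← mul_assoc, ← mul_assoc, ← Complex.exp_add,
      ← Complex.exp_add, add_assoc]
    congr 2
    simp only [inner_add_left, inner_add_right]
    push_cast
    ring
  have hS0 : ∀ φ, S 0 0 φ = φ := by
    intro φ; ext y; rw [hS]; simp
  have hph : ∀ t : ℝ, ‖Complex.exp (Complex.I * (t : ℂ))‖ = 1 := fun t => by
    rw [mul_comm, Complex.norm_exp_ofReal_mul_I]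
  have hup : ∀ x ξ φ, ‖J (S x ξ φ)‖ ≤ C₀ * ‖J φ‖ := by
    intro x ξ φ
    obtain ⟨f', hf', hn⟩ := hshift (J (S x ξ φ)) x ξ
    have h1 : inner ℂ (J (S x ξ φ)) (J (S x ξ φ)) = inner ℂ (J φ) f' := by
      rw [hJ, hJ, hf']
    have h2 : ‖J (S x ξ φ)‖ * ‖J (S x ξ φ)‖ ≤ ‖J φ‖ * (C₀ * ‖J (S x ξ φ)‖) := by
      rw [← inner_self_eq_norm_mul_norm (𝕜 := ℂ), h1]
      refine (RCLike.re_le_norm _).trans ((norm_inner_le_norm _ _).trans ?_)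
      gcongr
    rcases (norm_nonneg (J (S x ξ φ))).eq_or_lt with h0 | h0
    · rw [← h0]; positivity
    · refine le_of_mul_le_mul_right ?_ h0
      linarith
  have hlow : ∀ x ξ φ, ‖J φ‖ ≤ C₀ * ‖J (S x ξ φ)‖ := by
    intro x ξ φ
    have := hup (-x) (-ξ) (S x ξ φ)
    rw [hcomp, hJs, norm_smul, norm_star, hph, one_mul, neg_add_cancel, neg_add_cancel, hS0] at this
    exact this
  obtain ⟨M, Minv, Mconj, Mbd, Mup, Mlow⟩ :=
    exists_cmean (EuclideanSpace ℝ (Fin d) × EuclideanSpace ℝ (Fin d))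
  let T : EuclideanSpace ℝ (Fin d) × EuclideanSpace ℝ (Fin d) →
      𝓢(EuclideanSpace ℝ (Fin d), ℂ) → X := fun z φ => J (S z.1 z.2 φ)
  have hbd : ∀ φ χ z, ‖inner ℂ (T z φ) (T z χ)‖ ≤ C₀ * ‖J φ‖ * (C₀ * ‖J χ‖) := by
    intro φ χ z
    refine (norm_inner_le_norm _ _).trans ?_
    exact mul_le_mul (hup _ _ _) (hup _ _ _) (norm_nonneg _) (by positivity)
  refine ⟨fun φ χ => M (fun z => inner ℂ (T z φ) (T z χ)), fun χ => ?_, fun φ χ => ?_,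
    fun x ξ φ χ => ?_, fun φ => ⟨?_, ?_⟩⟩
  · choose g hg hgn using fun z : EuclideanSpace ℝ (Fin d) × EuclideanSpace ℝ (Fin d) =>
      hshift (T z χ) z.1 z.2
    have hK : ∀ z, ‖g z‖ ≤ C₀ * (C₀ * ‖J χ‖) := fun z =>
      (hgn z).trans (mul_le_mul_of_nonneg_left (hup _ _ _) hC₀.le)
    let ℓ : X →L[ℂ] ℂ := LinearMap.mkContinuous
      { toFun := fun f => M (fun z => inner ℂ (g z) f)
        map_add' := fun f f' => by
          rw [← map_add]; congr 1; funext z; simp [inner_add_right]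
        map_smul' := fun c f => by
          rw [RingHom.id_apply, ← map_smul]; congr 1; funext z; simp [inner_smul_right] }
      (2 * (C₀ * (C₀ * ‖J χ‖))) (fun f => by
        refine (Mbd _ (C₀ * (C₀ * ‖J χ‖) * ‖f‖) fun z => ?_).trans (le_of_eq (by ring))
        refine (norm_inner_le_norm _ _).trans ?_
        exact mul_le_mul_of_nonneg_right (hK z) (norm_nonneg _))
    obtain ⟨u, hu⟩ := exists_u j ((InnerProductSpace.toDual ℂ X).symm ℓ)
    refine ⟨u, fun φ => ?_⟩
    rw [hu, ← hJ, ← inner_conj_symm, InnerProductSpace.toDual_symm_apply]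
    show M (fun z => inner ℂ (T z φ) (T z χ)) = star (M (fun z => inner ℂ (g z) (J φ)))
    rw [← Mconj]
    congr 1; funext z
    show _ = (starRingEnd ℂ) _
    rw [inner_conj_symm, hJ, hJ, hg]
  · show M _ = star (M _)
    rw [← Mconj]
    congr 1; funext z
    exact (inner_conj_symm _ _).symm
  · show M _ = M _
    rw [← Minv (fun z => inner ℂ (T z φ) (T z χ)) _ (x, ξ) (hbd φ χ)]
    congr 1; funext z
    show inner ℂ (J (S z.1 z.2 (S x ξ φ))) (J (S z.1 z.2 (S x ξ χ))) =
      inner ℂ (J (S (z.1 + x) (z.2 + ξ) φ)) (J (S (z.1 + x) (z.2 + ξ) χ))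
    rw [hcomp, hcomp, hJs, hJs, inner_smul_left, inner_smul_right, ← mul_assoc]
    have : ∀ t : ℝ, (starRingEnd ℂ) (star (Complex.exp (Complex.I * (t : ℂ)))) *
        star (Complex.exp (Complex.I * (t : ℂ))) = 1 := by
      intro t
      have h := Complex.mul_conj (Complex.exp (Complex.I * (t : ℂ)))
      rw [Complex.normSq_eq_norm_sq, hph] at h
      simpa using h
    rw [this, one_mul]
  · refine Mlow _ _ _ (hbd φ φ) fun z => ?_
    have h1 : (inner ℂ (T z φ) (T z φ)).re = ‖T z φ‖ ^ 2 := inner_self_eq_norm_sq (𝕜 := ℂ) _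
    rw [h1, inv_mul_le_iff₀ (by positivity), ← mul_pow]
    exact pow_le_pow_left₀ (norm_nonneg _) (hlow _ _ _) 2
  · refine Mup _ _ _ (hbd φ φ) fun z => ?_
    have h1 : (inner ℂ (T z φ) (T z φ)).re = ‖T z φ‖ ^ 2 := inner_self_eq_norm_sq (𝕜 := ℂ) _
    rw [h1, ← mul_pow]
    exact pow_le_pow_left₀ (norm_nonneg _) (hup _ _ _) 2
end Form
end TFInv


namespace TFInv
open scoped SchwartzMap FourierTransform
section Key
variable {d : ℕ}

/-- Product of Schwartz functions. -/
noncomputable def mulS (a φ : 𝓢(EuclideanSpace ℝ (Fin d), ℂ)) : 𝓢(EuclideanSpace ℝ (Fin d), ℂ) :=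
  SchwartzMap.pairing (ContinuousLinearMap.mul ℂ ℂ) a φ

theorem mulS_apply (a φ : 𝓢(EuclideanSpace ℝ (Fin d), ℂ)) (y : EuclideanSpace ℝ (Fin d)) :
    mulS a φ y = a y * φ y := by
  simp [mulS, SchwartzMap.pairing_apply_apply]

/-- Complex conjugate of a Schwartz function. -/
noncomputable def conjS (a : 𝓢(EuclideanSpace ℝ (Fin d), ℂ)) : 𝓢(EuclideanSpace ℝ (Fin d), ℂ) :=
  SchwartzMap.postcompCLM (𝕜 := ℝ) (Complex.conjCLE : ℂ →L[ℝ] ℂ) a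

theorem conjS_apply (a : 𝓢(EuclideanSpace ℝ (Fin d), ℂ)) (y : EuclideanSpace ℝ (Fin d)) :
    conjS a y = star (a y) := by
  simp [conjS, SchwartzMap.postcompCLM_apply]

theorem fourier_rep (a : 𝓢(EuclideanSpace ℝ (Fin d), ℂ)) :
    ∃ m : 𝓢(EuclideanSpace ℝ (Fin d), ℂ), ∀ y, a y =
      ∫ ξ, m ξ * Complex.exp (Complex.I * ((-(2 * Real.pi) * inner ℝ y ξ : ℝ) : ℂ)) := by
  refine ⟨𝓕⁻ a, fun y => ?_⟩
  have h : a = 𝓕 (𝓕⁻ a) := by simp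
  conv_lhs => rw [h]
  rw [SchwartzMap.fourier_coe, Real.fourier_eq']
  congr 1; funext ξ
  rw [smul_eq_mul, mul_comm, real_inner_comm]
  congr 2
  push_cast; ring


theorem B_mul
    (S : EuclideanSpace ℝ (Fin d) → EuclideanSpace ℝ (Fin d) →
      (SchwartzMap (EuclideanSpace ℝ (Fin d)) ℂ →L[ℂ] SchwartzMap (EuclideanSpace ℝ (Fin d)) ℂ))
    (hS : ∀ (x ξ : EuclideanSpace ℝ (Fin d)) (φ : SchwartzMap (EuclideanSpace ℝ (Fin d)) ℂ)
        (z : EuclideanSpace ℝ (Fin d)),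
        S x ξ φ z = Complex.exp (Complex.I * ((inner ℝ z ξ + inner ℝ x ξ : ℝ) : ℂ)) * φ (z + x))
    (B : 𝓢(EuclideanSpace ℝ (Fin d), ℂ) → 𝓢(EuclideanSpace ℝ (Fin d), ℂ) → ℂ)
    (hBu : ∀ χ, ∃ u : 𝓢(EuclideanSpace ℝ (Fin d), ℂ) →L[ℂ] ℂ, ∀ φ, B φ χ = u φ)
    (hBc : ∀ φ χ, B χ φ = star (B φ χ))
    (hBS : ∀ x ξ φ χ, B (S x ξ φ) (S x ξ χ) = B φ χ)
    (a φ χ : 𝓢(EuclideanSpace ℝ (Fin d), ℂ)) :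
    B (mulS a φ) χ = B φ (mulS (conjS a) χ) := by
  obtain ⟨m, hm⟩ := fourier_rep a
  set c : ℝ := -(2 * Real.pi) with hc
  obtain ⟨u, hu⟩ := hBu χ
  obtain ⟨v, hv⟩ := hBu φ
  have h1 := lemma_M volume m φ c (fun ξ => S 0 (c • ξ) φ)
    (fun ξ y => by rw [hS]; simp [inner_smul_right]) (mulS a φ)
    (fun y => by rw [mulS_apply, hm]) u
  have h2 := lemma_M volume (conjS m) χ (-c) (fun ξ => S 0 (-(c • ξ)) χ)
    (fun ξ y => by rw [hS]; simp [inner_smul_right]) (mulS (conjS a) χ)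
    (fun y => by
      rw [mulS_apply, conjS_apply, hm]
      congr 1
      rw [← starRingEnd_apply, ← integral_conj]
      congr 1; funext ξ
      rw [conjS_apply, map_mul, ← Complex.exp_conj, starRingEnd_apply]
      congr 2
      rw [map_mul, Complex.conj_I, Complex.conj_ofReal]
      push_cast; ring) v
  rw [hu, h1, hBc (mulS (conjS a) χ) φ, hv, h2, ← starRingEnd_apply, ← integral_conj]
  congr 1; funext ξ
  rw [map_mul, conjS_apply, ← starRingEnd_apply, Complex.conj_conj, ← hu, ← hv, starRingEnd_apply, ← hBc]
  congr 1
  rw [← hBS 0 (c • ξ) φ]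
  congr 1
  ext y
  rw [hS, hS]
  simp [← mul_assoc, ← Complex.exp_add]

theorem B_key
    (S : EuclideanSpace ℝ (Fin d) → EuclideanSpace ℝ (Fin d) →
      (SchwartzMap (EuclideanSpace ℝ (Fin d)) ℂ →L[ℂ] SchwartzMap (EuclideanSpace ℝ (Fin d)) ℂ))
    (hS : ∀ (x ξ : EuclideanSpace ℝ (Fin d)) (φ : SchwartzMap (EuclideanSpace ℝ (Fin d)) ℂ)
        (z : EuclideanSpace ℝ (Fin d)),
        S x ξ φ z = Complex.exp (Complex.I * ((inner ℝ z ξ + inner ℝ x ξ : ℝ) : ℂ)) * φ (z + x))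
    (B : 𝓢(EuclideanSpace ℝ (Fin d), ℂ) → 𝓢(EuclideanSpace ℝ (Fin d), ℂ) → ℂ)
    (hBu : ∀ χ, ∃ u : 𝓢(EuclideanSpace ℝ (Fin d), ℂ) →L[ℂ] ℂ, ∀ φ, B φ χ = u φ)
    (hBc : ∀ φ χ, B χ φ = star (B φ χ))
    (hBS : ∀ x ξ φ χ, B (S x ξ φ) (S x ξ χ) = B φ χ)
    (a₁ a₂ φ χ : 𝓢(EuclideanSpace ℝ (Fin d), ℂ)) :
    (∫ x, a₁ x * a₂ x) * B φ χ = (∫ x, φ x * star (χ x)) * B a₁ (conjS a₂) := by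
  obtain ⟨u, hu⟩ := hBu χ
  obtain ⟨v, hv⟩ := hBu a₁
  have hτ : ∀ x y φ, S x 0 φ y = φ (y + x) := fun x y φ => by rw [hS]; simp
  have h1 := lemma_T volume (mulS a₁ a₂) φ (fun x => mulS (mulS (S x 0 a₂) φ) (S x 0 a₁))
    (fun x y => by simp only [mulS_apply, hτ]; ring) u
  have h2 := lemma_T volume (mulS (conjS φ) χ) (conjS a₂)
    (fun x => S x 0 (mulS (conjS (mulS (S (-x) 0 a₂) φ)) χ))
    (fun x y => by
      simp only [mulS_apply, hτ, conjS_apply, star_mul']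
      rw [add_neg_cancel_right]; ring) v
  simp only [mulS_apply] at h1
  rw [hu, h1]
  have h3 : ∀ x, u (mulS (mulS (S x 0 a₂) φ) (S x 0 a₁)) =
      star (v (S (-x) 0 (mulS (conjS (mulS (S (- -x) 0 a₂) φ)) χ))) := by
    intro x
    rw [← hu, B_mul S hS B hBu hBc hBS, ← hv, ← hBc, neg_neg, ← hBS (-x) 0]
    congr 1
    ext y
    rw [hτ, hτ, neg_add_cancel_right]
  simp only [h3]
  rw [integral_neg_eq_self (fun x => star (v (S x 0 (mulS (conjS (mulS (S (-x) 0 a₂) φ)) χ))))]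
  have h4 := integral_conj (𝕜 := ℂ) (μ := (volume : Measure (EuclideanSpace ℝ (Fin d))))
    (f := fun x => v (S x 0 (mulS (conjS (mulS (S (-x) 0 a₂) φ)) χ)))
  rw [← h2, map_mul, ← integral_conj, ← hv] at h4
  refine h4.trans ?_
  rw [starRingEnd_apply, ← hBc]
  congr 1
  congr 1; funext x
  simp [mulS_apply, conjS_apply]
end Key
end TFInv


namespace TFInv
open scoped SchwartzMap
section Final
variable {d : ℕ}

theorem riesz_ext {V H : Type*} [AddCommGroup V] [Module ℂ V] [NormedAddCommGroup H]
    [InnerProductSpace ℂ H] [CompleteSpace H] (e : V →ₗ[ℂ] H) (he : DenseRange e)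
    (l : V →ₗ[ℂ] ℂ) (C : ℝ) (hC : 0 ≤ C) (h : ∀ v, ‖l v‖ ≤ C * ‖e v‖) :
    ∃ w : H, (∀ v, inner ℂ w (e v) = l v) ∧ ‖w‖ ≤ C := by
  refine ⟨(InnerProductSpace.toDual ℂ H).symm (l.extendOfNorm e), fun v => ?_, ?_⟩
  · rw [InnerProductSpace.toDual_symm_apply, LinearMap.extendOfNorm_eq he ⟨C, h⟩]
  · rw [LinearIsometryEquiv.norm_map]
    exact LinearMap.opNorm_extendOfNorm_le he hC h

theorem conjS_conjS (a : 𝓢(EuclideanSpace ℝ (Fin d), ℂ)) : conjS (conjS a) = a := by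
  ext y; simp [conjS_apply]

theorem integral_eq_norm (a : 𝓢(EuclideanSpace ℝ (Fin d), ℂ)) :
    (∫ x, a x * star (a x)) = ((‖a.toLp 2 volume‖ ^ 2 : ℝ) : ℂ) := by
  have h := SchwartzMap.inner_toL2_toL2_eq a a
  rw [inner_self_eq_norm_sq_to_K] at h
  push_cast
  refine Eq.trans ?_ h.symm
  congr 1

theorem norm_conjS (a : 𝓢(EuclideanSpace ℝ (Fin d), ℂ)) :
    ‖(conjS a).toLp 2 volume‖ = ‖a.toLp 2 volume‖ := by
  have h1 := integral_eq_norm a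
  have h2 := integral_eq_norm (conjS a)
  have : (∫ x, conjS a x * star (conjS a x)) = ∫ x, a x * star (a x) := by
    congr 1; funext x; simp [conjS_apply, mul_comm]
  rw [this, h1] at h2
  have h3 : ‖a.toLp 2 volume‖ ^ 2 = ‖(conjS a).toLp 2 volume‖ ^ 2 := by exact_mod_cast h2
  exact ((sq_eq_sq₀ (norm_nonneg _) (norm_nonneg _)).1 h3).symm

variable {X : Type*} [NormedAddCommGroup X] [InnerProductSpace ℂ X] [CompleteSpace X]

theorem J_bounds [Nontrivial X]
    (j : X →L[ℂ] WeakDual ℂ (SchwartzMap (EuclideanSpace ℝ (Fin d)) ℂ))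
    (hj : Function.Injective j)
    (S : EuclideanSpace ℝ (Fin d) → EuclideanSpace ℝ (Fin d) →
      (SchwartzMap (EuclideanSpace ℝ (Fin d)) ℂ →L[ℂ] SchwartzMap (EuclideanSpace ℝ (Fin d)) ℂ))
    (hS : ∀ (x ξ : EuclideanSpace ℝ (Fin d)) (φ : SchwartzMap (EuclideanSpace ℝ (Fin d)) ℂ)
        (z : EuclideanSpace ℝ (Fin d)),
        S x ξ φ z = Complex.exp (Complex.I * ((inner ℝ z ξ + inner ℝ x ξ : ℝ) : ℂ)) * φ (z + x))
    (C₀ : ℝ) (hC₀ : 0 < C₀)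
    (hshift : ∀ (f : X) (x ξ : EuclideanSpace ℝ (Fin d)),
        ∃ f' : X, (∀ φ, j f' φ = j f (S x ξ φ)) ∧ ‖f'‖ ≤ C₀ * ‖f‖)
    (J : 𝓢(EuclideanSpace ℝ (Fin d), ℂ) → X) (hJ : ∀ φ f, inner ℂ (J φ) f = j f φ) :
    ∃ c₁ c₂ : ℝ, 0 < c₁ ∧ 0 < c₂ ∧ ∀ φ, c₁ * ‖φ.toLp 2 volume‖ ≤ ‖J φ‖ ∧
      ‖J φ‖ ≤ c₂ * ‖φ.toLp 2 volume‖ := by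
  obtain ⟨B, hBu, hBc, hBS, hBn⟩ := exists_form j S hS C₀ hC₀ hshift J hJ
  have hex : ∃ a, J a ≠ 0 := by
    by_contra! h
    obtain ⟨f, hf⟩ := exists_ne (0 : X)
    refine hf (hj ?_)
    rw [map_zero]
    refine ContinuousLinearMap.ext fun φ => ?_
    have := hJ φ f
    rw [h, inner_zero_left] at this
    exact this.symm
  obtain ⟨a, ha⟩ := hex
  have haN : 0 < ‖a.toLp 2 volume‖ ^ 2 := by
    have : a.toLp 2 volume ≠ 0 := by
      intro h0
      have h1 : a = 0 := SchwartzMap.injective_toLp (p := 2) (μ := volume) (by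
        show a.toLp 2 volume = SchwartzMap.toLp 0 2 volume
        rw [h0]; exact (map_zero (SchwartzMap.toLpCLM ℂ ℂ 2 volume)).symm)
      refine ha (ext_inner_right ℂ fun f => ?_)
      rw [hJ, h1, map_zero, inner_zero_left]
    positivity
  have haB : 0 < (B a a).re := lt_of_lt_of_le (by positivity) (hBn a).1
  set b := (B a a).re / ‖a.toLp 2 volume‖ ^ 2 with hb
  have hb0 : 0 < b := by positivity
  have key : ∀ φ, (B φ φ).re = b * ‖φ.toLp 2 volume‖ ^ 2 := by
    intro φ
    have h := B_key S hS B hBu hBc hBS a (conjS a) φ φ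
    rw [conjS_conjS] at h
    simp only [conjS_apply] at h
    rw [integral_eq_norm, integral_eq_norm] at h
    have h2 := congrArg Complex.re h
    rw [Complex.re_ofReal_mul, Complex.re_ofReal_mul] at h2
    rw [hb, div_mul_eq_mul_div, eq_div_iff haN.ne']; linarith
  refine ⟨C₀⁻¹ * √b, C₀ * √b, by positivity, by positivity, fun φ => ⟨?_, ?_⟩⟩
  · refine le_of_sq_le_sq ?_ (norm_nonneg _)
    have := (hBn φ).2
    rw [key] at this
    rw [mul_pow, mul_pow, Real.sq_sqrt hb0.le, inv_pow, mul_assoc, inv_mul_le_iff₀ (by positivity)]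
    exact this
  · refine le_of_sq_le_sq ?_ (by positivity)
    have := (hBn φ).1
    rw [key, inv_mul_le_iff₀ (by positivity)] at this
    rw [mul_pow, mul_pow, Real.sq_sqrt hb0.le, mul_assoc]
    exact this

theorem exists_J2
    (j : X →L[ℂ] WeakDual ℂ (SchwartzMap (EuclideanSpace ℝ (Fin d)) ℂ))
    (hj : Function.Injective j)
    (J : 𝓢(EuclideanSpace ℝ (Fin d), ℂ) → X) (hJ : ∀ φ f, inner ℂ (J φ) f = j f φ) :
    ∃ K : 𝓢(EuclideanSpace ℝ (Fin d), ℂ) →ₗ[ℂ] X, (∀ φ, K φ = J (conjS φ)) ∧ DenseRange K := by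
  refine ⟨{ toFun := fun φ => J (conjS φ), map_add' := fun φ ψ => ?_, map_smul' := fun c φ => ?_ },
    fun φ => rfl, ?_⟩
  · refine ext_inner_right ℂ fun f => ?_
    rw [inner_add_left, hJ, hJ, hJ, ← map_add]
    congr 1; ext y; simp [conjS_apply]
  · refine ext_inner_right ℂ fun f => ?_
    rw [RingHom.id_apply, inner_smul_left, hJ, hJ, ← smul_eq_mul, ← map_smul]
    congr 1; ext y; simp [conjS_apply]
  · set K : 𝓢(EuclideanSpace ℝ (Fin d), ℂ) →ₗ[ℂ] X :=
      { toFun := fun φ => J (conjS φ), map_add' := _, map_smul' := _ } with hK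
    have : Dense ((LinearMap.range K : Submodule ℂ X) : Set X) := by
      rw [Submodule.dense_iff_topologicalClosure_eq_top, Submodule.topologicalClosure_eq_top_iff,
        Submodule.eq_bot_iff]
      intro f hf
      refine hj ?_
      rw [map_zero]
      refine ContinuousLinearMap.ext fun φ => ?_
      have h := (Submodule.mem_orthogonal _ _).1 hf (K (conjS φ)) ⟨_, rfl⟩
      have h2 : K (conjS φ) = J φ := by
        show J (conjS (conjS φ)) = J φ
        rw [conjS_conjS]
      rw [h2, hJ] at h
      exact h
    exact this

theorem inner_toLp (g : Lp ℂ 2 (volume : Measure (EuclideanSpace ℝ (Fin d))))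
    (φ : 𝓢(EuclideanSpace ℝ (Fin d), ℂ)) :
    inner ℂ g (φ.toLp 2 volume) = star (∫ y, g y * conjS φ y) := by
  rw [L2.inner_def, ← starRingEnd_apply, ← integral_conj]
  refine integral_congr_ae ?_
  filter_upwards [φ.coeFn_toLp 2 volume] with y hy
  rw [hy]
  simp [conjS_apply, mul_comm]

end Final
end TFInv

/-- Let `X` be a nonzero complex Hilbert space with an injective continuous linear map
`j : X → 𝓢'(ℝ^d)` into tempered distributions (the continuous dual of the Schwartz space
with its weak-* topology).  For `x, ξ ∈ ℝ^d`, the time–frequency shift on tempered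
distributions is defined by duality as the transpose `u ↦ u ∘ S x ξ` of the continuous
linear operator `S x ξ` on `𝓢(ℝ^d)` given by `(S x ξ φ)(z) = e^{i(⟨z,ξ⟩+⟨x,ξ⟩)} φ(z + x)`
(so that on functions it extends `f ↦ f(· − x) e^{i⟨·,ξ⟩}`).  Assume there is `C₀ > 0`
such that for every `f ∈ X` and all `x, ξ ∈ ℝ^d` the shifted distribution of `j f` lies
in `j(X)`, with preimage of norm at most `C₀ ‖f‖`.  Then `j(X)` coincides with the image
of `L²(ℝ^d; ℂ)` under its canonical embedding `g ↦ (φ ↦ ∫ g φ)` into `𝓢'(ℝ^d)`, and the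
norms correspond up to constants:  `X = L²(ℝ^d)` with equivalent norms. -/
theorem stmt10 (d : ℕ)
    {X : Type*} [NormedAddCommGroup X] [InnerProductSpace ℂ X] [CompleteSpace X]
    [Nontrivial X]
    (j : X →L[ℂ] WeakDual ℂ (SchwartzMap (EuclideanSpace ℝ (Fin d)) ℂ))
    (hj : Function.Injective j)
    (S : EuclideanSpace ℝ (Fin d) → EuclideanSpace ℝ (Fin d) →
      (SchwartzMap (EuclideanSpace ℝ (Fin d)) ℂ →L[ℂ] SchwartzMap (EuclideanSpace ℝ (Fin d)) ℂ))
    (hS : ∀ (x ξ : EuclideanSpace ℝ (Fin d)) (φ : SchwartzMap (EuclideanSpace ℝ (Fin d)) ℂ)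
        (z : EuclideanSpace ℝ (Fin d)),
        S x ξ φ z = Complex.exp (Complex.I * ((⟪z, ξ⟫_ℝ + ⟪x, ξ⟫_ℝ : ℝ) : ℂ)) * φ (z + x))
    (C₀ : ℝ) (hC₀ : 0 < C₀)
    (hshift : ∀ (f : X) (x ξ : EuclideanSpace ℝ (Fin d)),
        ∃ f' : X, (∀ φ, j f' φ = j f (S x ξ φ)) ∧ ‖f'‖ ≤ C₀ * ‖f‖) :
    (Set.range j = {u : WeakDual ℂ (SchwartzMap (EuclideanSpace ℝ (Fin d)) ℂ) |
        ∃ g : Lp ℂ 2 (volume : Measure (EuclideanSpace ℝ (Fin d))),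
          ∀ φ : SchwartzMap (EuclideanSpace ℝ (Fin d)) ℂ,
            u φ = ∫ y, (g : EuclideanSpace ℝ (Fin d) → ℂ) y * φ y}) ∧
    ∃ c C : ℝ, 0 < c ∧ 0 < C ∧
      ∀ (f : X) (g : Lp ℂ 2 (volume : Measure (EuclideanSpace ℝ (Fin d)))),
        (∀ φ : SchwartzMap (EuclideanSpace ℝ (Fin d)) ℂ,
          j f φ = ∫ y, (g : EuclideanSpace ℝ (Fin d) → ℂ) y * φ y) →
        c * ‖g‖ ≤ ‖f‖ ∧ ‖f‖ ≤ C * ‖g‖ := by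
  obtain ⟨J, hJ⟩ := TFInv.exists_J j
  obtain ⟨c₁, c₂, hc₁, hc₂, hb⟩ := TFInv.J_bounds j hj S hS C₀ hC₀ hshift J hJ
  obtain ⟨K, hK, hKd⟩ := TFInv.exists_J2 j hj J hJ
  set P : SchwartzMap (EuclideanSpace ℝ (Fin d)) ℂ →ₗ[ℂ]
      Lp ℂ 2 (volume : Measure (EuclideanSpace ℝ (Fin d))) :=
    (SchwartzMap.toLpCLM ℂ ℂ 2 volume).toLinearMap with hP
  have hPa : ∀ φ, P φ = φ.toLp 2 volume := fun φ => rfl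
  have hPd : DenseRange P :=
    SchwartzMap.denseRange_toLpCLM (F := ℂ) (p := 2) ENNReal.ofNat_ne_top
  have hKb : ∀ φ, c₁ * ‖P φ‖ ≤ ‖K φ‖ ∧ ‖K φ‖ ≤ c₂ * ‖P φ‖ := by
    intro φ
    have := hb (TFInv.conjS φ)
    rw [TFInv.norm_conjS] at this
    rw [hK, hPa]; exact this
  have hKj : ∀ f φ, inner ℂ f (K φ) = star (j f (TFInv.conjS φ)) := by
    intro f φ
    rw [← hJ, hK, ← starRingEnd_apply, inner_conj_symm]
  -- matching criterion
  have hmatch : ∀ (f : X) (g : Lp ℂ 2 (volume : Measure (EuclideanSpace ℝ (Fin d)))),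
      (∀ φ : SchwartzMap (EuclideanSpace ℝ (Fin d)) ℂ,
        j f φ = ∫ y, (g : EuclideanSpace ℝ (Fin d) → ℂ) y * φ y) ↔
      ∀ φ, inner ℂ f (K φ) = inner ℂ g (P φ) := by
    intro f g
    constructor
    · intro h φ
      rw [hKj, h, hPa, TFInv.inner_toLp]
    · intro h φ
      have h1 := h (TFInv.conjS φ)
      rw [hKj, hPa, TFInv.inner_toLp, TFInv.conjS_conjS] at h1
      exact star_injective h1
  have hXL : ∀ f : X, ∃ g : Lp ℂ 2 (volume : Measure (EuclideanSpace ℝ (Fin d))),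
      (∀ φ, inner ℂ f (K φ) = inner ℂ g (P φ)) ∧ ‖g‖ ≤ c₂ * ‖f‖ := by
    intro f
    obtain ⟨g, hg, hgn⟩ := TFInv.riesz_ext P hPd ((innerSL ℂ f).toLinearMap ∘ₗ K) (c₂ * ‖f‖)
      (by positivity) (fun φ => by
        refine (norm_inner_le_norm (𝕜 := ℂ) f (K φ)).trans ?_
        have := mul_le_mul_of_nonneg_left (hKb φ).2 (norm_nonneg f)
        linarith)
    exact ⟨g, fun φ => (hg φ).symm, hgn⟩
  have hLX : ∀ g : Lp ℂ 2 (volume : Measure (EuclideanSpace ℝ (Fin d))), ∃ f : X,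
      (∀ φ, inner ℂ f (K φ) = inner ℂ g (P φ)) ∧ ‖f‖ ≤ c₁⁻¹ * ‖g‖ := by
    intro g
    obtain ⟨f, hf, hfn⟩ := TFInv.riesz_ext K hKd ((innerSL ℂ g).toLinearMap ∘ₗ P) (c₁⁻¹ * ‖g‖)
      (by positivity) (fun φ => by
        refine (norm_inner_le_norm (𝕜 := ℂ) g (P φ)).trans ?_
        have h1 : ‖P φ‖ ≤ c₁⁻¹ * ‖K φ‖ := by
          rw [le_inv_mul_iff₀ hc₁]; exact (hKb φ).1
        have := mul_le_mul_of_nonneg_left h1 (norm_nonneg g)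
        linarith)
    exact ⟨f, hf, hfn⟩
  refine ⟨?_, c₂⁻¹, c₁⁻¹, by positivity, by positivity, fun f g hfg => ?_⟩
  · ext u
    constructor
    · rintro ⟨f, rfl⟩
      obtain ⟨g, hg, -⟩ := hXL f
      exact ⟨g, (hmatch f g).2 hg⟩
    · rintro ⟨g, hg⟩
      obtain ⟨f, hf, -⟩ := hLX g
      refine ⟨f, ContinuousLinearMap.ext fun φ => ?_⟩
      exact ((hmatch f g).2 hf φ).trans (hg φ).symm
  · rw [hmatch] at hfg
    obtain ⟨g', hg', hgn⟩ := hXL f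
    obtain ⟨f', hf', hfn⟩ := hLX g
    have e1 : g = g' := hPd.eq_of_inner_left ℂ fun φ => by rw [← hfg, hg']
    have e2 : f = f' := hKd.eq_of_inner_left ℂ fun φ => by rw [hfg, hf']
    subst e1 e2
    refine ⟨?_, hfn⟩
    rw [inv_mul_le_iff₀ hc₂]
    exact hgn
end
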